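/- Suppose in addition that each edge cost function ℓ_e^s is differentiable on (0,∞) with derivative bounded below by some constant α > 0. Then the map θ ↦ w*(θ), assigning to each belief θ ∈ Δ(S) the unique equilibrium edge load vector of the routing game for θ, is continuous on the simplex Δ(S). -/

import Mathlib

/-!
Statement 4: Continuity of the equilibrium edge load map θ ↦ w*(θ) on the
belief simplex Δ(S), when edge cost derivatives are bounded below by α > 0.
-/

open Finset

/-- Edge load induced by a routing strategy `q`. -/
def edgeLoad {E R : Type*} [Fintype R] [DecidableEq E]
    (route : R → Finset E) (q : R → ℝ) (e : E) : ℝ :=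
  ∑ r ∈ Finset.univ.filter (fun r => e ∈ route r), q r

/-- A feasible strategy: nonnegative route flows summing to the demand `D`. -/
def Feasible {R : Type*} [Fintype R] (D : ℝ) (q : R → ℝ) : Prop :=
  (∀ r, 0 ≤ q r) ∧ ∑ r, q r = D

/-- Expected cost of route `r` at strategy `q`, under belief `θ` on the states. -/
def expRouteCost {E R S : Type*} [Fintype R] [Fintype S] [DecidableEq E]
    (route : R → Finset E) (ℓ : E → S → ℝ → ℝ) (θ : S → ℝ) (q : R → ℝ) (r : R) : ℝ :=
  ∑ s, θ s * ∑ e ∈ route r, ℓ e s (edgeLoad route q e)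

/-- A Wardrop equilibrium for belief `θ`: a feasible strategy such that every route
carrying positive flow attains the minimum expected cost over all routes. -/
def IsWardrop {E R S : Type*} [Fintype R] [Fintype S] [DecidableEq E]
    (route : R → Finset E) (ℓ : E → S → ℝ → ℝ) (D : ℝ) (θ : S → ℝ) (q : R → ℝ) : Prop :=
  Feasible D q ∧ ∀ r, 0 < q r → ∀ r',
    expRouteCost route ℓ θ q r ≤ expRouteCost route ℓ θ q r'

/-- A belief on the finite state set: a probability vector. -/
def IsBelief {S : Type*} [Fintype S] (θ : S → ℝ) : Prop :=
  (∀ s, 0 ≤ θ s) ∧ ∑ s, θ s = 1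

/-- Total cost of the flow `p` at the route costs induced by `q`, aggregated over edges. -/
lemma sum_mul_expRouteCost {E R S : Type*} [Fintype E] [Fintype R] [Fintype S] [DecidableEq E]
    (route : R → Finset E) (ℓ : E → S → ℝ → ℝ) (θ : S → ℝ) (p q : R → ℝ) :
    ∑ r, p r * expRouteCost route ℓ θ q r =
      ∑ e, (∑ s, θ s * ℓ e s (edgeLoad route q e)) * edgeLoad route p e := by
  have h : ∀ r, p r * expRouteCost route ℓ θ q r =
      ∑ e, if e ∈ route r then (∑ s, θ s * ℓ e s (edgeLoad route q e)) * p r else 0 := by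
    intro r
    rw [← Finset.sum_filter, Finset.filter_mem_eq_inter, Finset.univ_inter, ← Finset.sum_mul,
      mul_comm, Finset.sum_comm]
    simp only [expRouteCost, Finset.mul_sum]
  simp only [h]
  rw [Finset.sum_comm]
  refine Finset.sum_congr rfl fun e _ => ?_
  rw [← Finset.sum_filter, ← Finset.mul_sum]
  rfl

/-- A Wardrop equilibrium satisfies the variational inequality in terms of edge loads. -/
lemma IsWardrop.sum_mul_edgeLoad_le {E R S : Type*} [Fintype E] [Fintype R] [Fintype S]
    [DecidableEq E] {route : R → Finset E} {ℓ : E → S → ℝ → ℝ} {D : ℝ} {θ : S → ℝ} {p q : R → ℝ}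
    (hq : IsWardrop route ℓ D θ q) (hD : 0 < D) (hp : Feasible D p) :
    ∑ e, (∑ s, θ s * ℓ e s (edgeLoad route q e)) * edgeLoad route q e ≤
      ∑ e, (∑ s, θ s * ℓ e s (edgeLoad route q e)) * edgeLoad route p e := by
  rw [← sum_mul_expRouteCost, ← sum_mul_expRouteCost]
  obtain ⟨⟨hq0, hqD⟩, hmin⟩ := hq
  obtain ⟨r₀, -, hr₀⟩ : ∃ r ∈ Finset.univ, 0 < q r :=
    Finset.exists_lt_of_sum_lt (by simpa [hqD] using hD)
  calc ∑ r, q r * expRouteCost route ℓ θ q r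
      ≤ ∑ r, q r * expRouteCost route ℓ θ q r₀ := by
        refine Finset.sum_le_sum fun r _ => ?_
        rcases (hq0 r).eq_or_lt with h | h
        · simp [← h]
        · exact mul_le_mul_of_nonneg_left (hmin r h r₀) h.le
    _ = ∑ r, p r * expRouteCost route ℓ θ q r₀ := by
        rw [← Finset.sum_mul, ← Finset.sum_mul, hqD, hp.2]
    _ ≤ _ := Finset.sum_le_sum fun r _ => mul_le_mul_of_nonneg_left (hmin r₀ hr₀ r) (hp.1 r)

lemma Feasible.edgeLoad_nonneg {E R : Type*} [Fintype R] [DecidableEq E] {D : ℝ} {q : R → ℝ}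
    (hq : Feasible D q) (route : R → Finset E) (e : E) : 0 ≤ edgeLoad route q e :=
  Finset.sum_nonneg fun r _ => hq.1 r

lemma Feasible.edgeLoad_le {E R : Type*} [Fintype R] [DecidableEq E] {D : ℝ} {q : R → ℝ}
    (hq : Feasible D q) (route : R → Finset E) (e : E) : edgeLoad route q e ≤ D :=
  (Finset.sum_le_sum_of_subset_of_nonneg (Finset.filter_subset _ _) fun r _ _ => hq.1 r).trans
    hq.2.le

/-- A function with derivative at least `α` on `(0, ∞)` is strongly monotone on `[0, ∞)`. -/
lemma mul_sq_sub_le_of_le_hasDerivAt {f : ℝ → ℝ} {α : ℝ} (hf : ContinuousOn f (Set.Ici 0))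
    (hf' : ∀ x : ℝ, 0 < x → ∃ d : ℝ, HasDerivAt f d x ∧ α ≤ d) {x y : ℝ} (hx : 0 ≤ x)
    (hy : 0 ≤ y) : α * (y - x) ^ 2 ≤ (f y - f x) * (y - x) := by
  have key : ∀ a ∈ Set.Ici (0 : ℝ), ∀ b ∈ Set.Ici (0 : ℝ), a ≤ b → α * (b - a) ≤ f b - f a := by
    refine (convex_Ici 0).mul_sub_le_image_sub_of_le_deriv hf ?_ ?_
    · intro z hz
      rw [interior_Ici] at hz
      obtain ⟨d, hd, -⟩ := hf' z hz
      exact hd.differentiableAt.differentiableWithinAt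
    · intro z hz
      rw [interior_Ici] at hz
      obtain ⟨d, hd, h⟩ := hf' z hz
      rwa [hd.deriv]
  rcases le_total x y with h | h
  · nlinarith [key x hx y hy h]
  · nlinarith [key y hy x hx h]

/-- Equilibrium loads for two beliefs differ by at most the perturbation of the expected edge
costs at the first load. -/
lemma IsWardrop.mul_sum_sq_sub_le {E R S : Type*} [Fintype E] [Fintype R] [Fintype S]
    [DecidableEq E] {route : R → Finset E} {ℓ : E → S → ℝ → ℝ} {α D : ℝ} {θ η : S → ℝ}
    {q p : R → ℝ} (hcont : ∀ e s, ContinuousOn (ℓ e s) (Set.Ici 0))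
    (hderiv : ∀ e s (x : ℝ), 0 < x → ∃ d : ℝ, HasDerivAt (ℓ e s) d x ∧ α ≤ d)
    (hD : 0 < D) (hη : IsBelief η) (hq : IsWardrop route ℓ D θ q) (hp : IsWardrop route ℓ D η p) :
    α * ∑ e, (edgeLoad route p e - edgeLoad route q e) ^ 2 ≤
      D * ∑ e, |∑ s, (θ s - η s) * ℓ e s (edgeLoad route q e)| := by
  have h₁ := hq.sum_mul_edgeLoad_le hD hp.1
  have h₂ := hp.sum_mul_edgeLoad_le hD hq.1
  have hstrong : ∀ e, α * (edgeLoad route p e - edgeLoad route q e) ^ 2 ≤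
      (∑ s, η s * ℓ e s (edgeLoad route p e) - ∑ s, η s * ℓ e s (edgeLoad route q e)) *
        (edgeLoad route p e - edgeLoad route q e) := by
    intro e
    rw [← Finset.sum_sub_distrib, Finset.sum_mul]
    calc α * (edgeLoad route p e - edgeLoad route q e) ^ 2
        = ∑ s, η s * (α * (edgeLoad route p e - edgeLoad route q e) ^ 2) := by
          rw [← Finset.sum_mul, hη.2, one_mul]
      _ ≤ _ := Finset.sum_le_sum fun s _ => by
          have := mul_le_mul_of_nonneg_left (mul_sq_sub_le_of_le_hasDerivAt (hcont e s)
            (hderiv e s) (hq.1.edgeLoad_nonneg route e) (hp.1.edgeLoad_nonneg route e)) (hη.1 s)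
          linarith
  have hpert : ∀ e, (∑ s, θ s * ℓ e s (edgeLoad route q e) -
      ∑ s, η s * ℓ e s (edgeLoad route q e)) * (edgeLoad route p e - edgeLoad route q e) ≤
      D * |∑ s, (θ s - η s) * ℓ e s (edgeLoad route q e)| := by
    intro e
    simp only [sub_mul (θ _), Finset.sum_sub_distrib]
    refine (le_abs_self _).trans ?_
    rw [abs_mul, mul_comm]
    refine mul_le_mul_of_nonneg_right ?_ (abs_nonneg _)
    have := hq.1.edgeLoad_nonneg route e
    have := hp.1.edgeLoad_nonneg route e
    have := hq.1.edgeLoad_le route e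
    have := hp.1.edgeLoad_le route e
    rw [abs_le]
    constructor <;> linarith
  have h₃ := Finset.sum_le_sum fun e (_ : e ∈ Finset.univ) => hstrong e
  have h₄ := Finset.sum_le_sum fun e (_ : e ∈ Finset.univ) => hpert e
  rw [← Finset.mul_sum] at h₃ h₄
  refine le_trans ?_ h₄
  simp only [sub_mul, mul_sub, Finset.sum_sub_distrib] at h₃ ⊢
  linarith

theorem equilibrium_load_continuous_in_belief
    {E R S : Type*} [Fintype E] [Fintype R] [Fintype S] [DecidableEq E]
    [Nonempty R] [Nonempty S]
    (route : R → Finset E) (hroute : ∀ r, (route r).Nonempty)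
    (ℓ : E → S → ℝ → ℝ)
    (hcont : ∀ e s, ContinuousOn (ℓ e s) (Set.Ici 0))
    (hmono : ∀ e s, StrictMonoOn (ℓ e s) (Set.Ici 0))
    (α : ℝ) (hα : 0 < α)
    (hderiv : ∀ e s (x : ℝ), 0 < x → ∃ d : ℝ, HasDerivAt (ℓ e s) d x ∧ α ≤ d)
    (D : ℝ) (hD : 0 < D)
    (wstar : (S → ℝ) → E → ℝ)
    (hws : ∀ θ : S → ℝ, IsBelief θ →
      (∃ q : R → ℝ, IsWardrop route ℓ D θ q ∧ edgeLoad route q = wstar θ) ∧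
      (∀ q : R → ℝ, IsWardrop route ℓ D θ q → edgeLoad route q = wstar θ)) :
    ContinuousOn wstar {θ : S → ℝ | IsBelief θ} := by
  intro θ hθ
  obtain ⟨q, hq, hqw⟩ := (hws θ hθ).1
  refine tendsto_pi_nhds.2 fun e => ?_
  set g : (S → ℝ) → ℝ := fun η =>
    D / α * ∑ e, |∑ s, (θ s - η s) * ℓ e s (edgeLoad route q e)| with hg
  have hbound : ∀ η, IsBelief η → (wstar η e - wstar θ e) ^ 2 ≤ g η := by
    intro η hη
    obtain ⟨p, hp, hpw⟩ := (hws η hη).1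
    have h := hq.mul_sum_sq_sub_le hcont hderiv hD hη hp
    rw [hpw, hqw] at h
    have h' := Finset.single_le_sum (f := fun e => (wstar η e - wstar θ e) ^ 2)
      (fun e _ => sq_nonneg _) (Finset.mem_univ e)
    refine h'.trans ?_
    simp only [hg]
    rw [div_mul_eq_mul_div, le_div_iff₀ hα, mul_comm, hqw]
    exact h
  have hg_lim : Filter.Tendsto (fun η => √(g η)) (nhdsWithin θ {θ | IsBelief θ}) (nhds 0) := by
    have hc : Continuous fun η => √(g η) := by fun_prop
    have h := hc.tendsto θ
    simp only [hg, sub_self, zero_mul, Finset.sum_const_zero, abs_zero, mul_zero,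
      Real.sqrt_zero] at h
    exact h.mono_left nhdsWithin_le_nhds
  rw [tendsto_iff_dist_tendsto_zero]
  refine squeeze_zero' (.of_forall fun _ => dist_nonneg) ?_ hg_lim
  filter_upwards [self_mem_nhdsWithin] with η hη
  exact Real.abs_le_sqrt (hbound η hη)
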